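/- arXiv:2109.06521 — 2 statements merged into one kernel-verified Lean document; each statement's English description precedes it below -/
import Mathlib

section
/- Let G = (ρ, V, w) be a rooted directed weighted graph with N ≥ 1 non-root nodes and let L be its spanning-tree Laplacian. Then det L = ∑_{t∈T(G)} ∏_{(i,j)∈t} w_{ij}; i.e., the determinant of L equals the normalizing constant Z over all directed spanning trees rooted at ρ (the directed Matrix–Tree Theorem). -/
/-!
Nodes of a rooted directed weighted graph with `N` non-root nodes are encoded as
`Fin (N + 1)`, with the root `ρ` being `0` and the non-root nodes `1, …, N` being
`j.succ` for `j : Fin N`.  A candidate (spanning) tree is encoded by a parent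
function `par : Fin N → Fin (N + 1)` assigning to each non-root node `j` the tail
of its unique incoming edge `(par j, j.succ)`.
-/

/-- One step upwards towards the root along the parent function (the root is a fixed point). -/
def Step {N : ℕ} (par : Fin N → Fin (N + 1)) : Fin (N + 1) → Fin (N + 1) :=
  fun v => if h : v = 0 then 0 else par (v.pred h)

/-- `par` encodes a directed spanning tree rooted at `0`: every node has exactly one
incoming edge (built into the encoding) and there are no cycles, i.e. every node
reaches the root. -/
def IsSTree {N : ℕ} (par : Fin N → Fin (N + 1)) : Prop :=
  ∀ v : Fin (N + 1), (Step par)^[N] v = 0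

instance {N : ℕ} (par : Fin N → Fin (N + 1)) : Decidable (IsSTree par) :=
  inferInstanceAs (Decidable (∀ v : Fin (N + 1), (Step par)^[N] v = 0))

/-- A dependency tree: a spanning tree with exactly one edge emanating from the root. -/
def IsDTree {N : ℕ} (par : Fin N → Fin (N + 1)) : Prop :=
  IsSTree par ∧ (Finset.univ.filter fun j : Fin N => par j = 0).card = 1

instance {N : ℕ} (par : Fin N → Fin (N + 1)) : Decidable (IsDTree par) :=
  inferInstanceAs (Decidable (IsSTree par ∧
    (Finset.univ.filter fun j : Fin N => par j = 0).card = 1))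

/-- The weight of a tree: the product of its edge weights. -/
def treeWeight {N : ℕ} (w : Fin (N + 1) → Fin (N + 1) → ℝ)
    (par : Fin N → Fin (N + 1)) : ℝ :=
  ∏ j : Fin N, w (par j) j.succ

/-- The spanning-tree Laplacian: rows/columns indexed by the non-root nodes
`1, …, N+1` (encoded as `Fin (N+1)`); the diagonal entry at `j` is the total incoming
weight `∑_{i' ∈ V ∖ {j}} w_{i'j}` (including `i' = ρ`), and off-diagonal entries are
negated edge weights. -/
def stLap {N : ℕ} (w : Fin (N + 2) → Fin (N + 2) → ℝ) :
    Matrix (Fin (N + 1)) (Fin (N + 1)) ℝ :=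
  Matrix.of fun i j =>
    if i = j then ∑ i' ∈ Finset.univ.erase j.succ, w i' j.succ
    else -w i.succ j.succ

open Polynomial in
/-- A nilpotent matrix over a field has characteristic polynomial `X ^ card n`. -/
theorem Matrix.charpoly_eq_X_pow_of_isNilpotent {n K : Type*} [Fintype n] [DecidableEq n]
    [Field K] {M : Matrix n n K} (hM : IsNilpotent M) :
    M.charpoly = X ^ Fintype.card n :=
  sub_eq_zero.mp (Matrix.isNilpotent_charpoly_sub_pow_of_isNilpotent hM).eq_zero

theorem Matrix.pow_card_eq_zero_of_isNilpotent {n K : Type*} [Fintype n] [DecidableEq n]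
    [Field K] {M : Matrix n n K} (hM : IsNilpotent M) : M ^ Fintype.card n = 0 := by
  simpa [Matrix.charpoly_eq_X_pow_of_isNilpotent hM] using M.aeval_self_charpoly

theorem Matrix.det_one_sub_of_isNilpotent {n K : Type*} [Fintype n] [DecidableEq n]
    [Field K] {M : Matrix n n K} (hM : IsNilpotent M) : (1 - M).det = 1 := by
  have h := M.eval_charpoly 1
  rw [Matrix.charpoly_eq_X_pow_of_isNilpotent hM] at h
  simpa using h.symm

/-- The `0`-`1` matrix of a parent function, restricted to the non-root nodes. -/
def parentMatrix {N : ℕ} (par : Fin N → Fin (N + 1)) : Matrix (Fin N) (Fin N) ℝ :=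
  Matrix.of fun i j => if par i = j.succ then 1 else 0

theorem parentMatrix_apply {N : ℕ} (par : Fin N → Fin (N + 1)) (i j : Fin N) :
    parentMatrix par i j = if par i = j.succ then 1 else 0 :=
  rfl

@[simp]
theorem Step_zero {N : ℕ} (par : Fin N → Fin (N + 1)) : Step par 0 = 0 := by
  simp [Step]

@[simp]
theorem Step_succ {N : ℕ} (par : Fin N → Fin (N + 1)) (i : Fin N) :
    Step par i.succ = par i := by
  simp [Step]

theorem Step_iterate_zero {N : ℕ} (par : Fin N → Fin (N + 1)) (n : ℕ) :
    (Step par)^[n] 0 = 0 :=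
  Function.iterate_fixed (Step_zero par) n

theorem parentMatrix_pow_apply {N : ℕ} (par : Fin N → Fin (N + 1)) (n : ℕ) (i j : Fin N) :
    (parentMatrix par ^ n) i j = if (Step par)^[n] i.succ = j.succ then 1 else 0 := by
  induction n generalizing i with
  | zero => simp [Matrix.one_apply]
  | succ n ih =>
    rw [pow_succ', Matrix.mul_apply]
    simp only [ih, parentMatrix_apply, Function.iterate_succ_apply, Step_succ, ite_mul,
      one_mul, zero_mul]
    rcases Fin.eq_zero_or_eq_succ (par i) with h | ⟨k, h⟩
    · simp [h, Step_iterate_zero, (Fin.succ_ne_zero _).symm]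
    · simp [h]

theorem parentMatrix_pow_eq_zero_iff {N : ℕ} (par : Fin N → Fin (N + 1)) (n : ℕ) :
    parentMatrix par ^ n = 0 ↔ ∀ v, (Step par)^[n] v = 0 := by
  constructor
  · intro h v
    rcases Fin.eq_zero_or_eq_succ v with rfl | ⟨i, rfl⟩
    · exact Step_iterate_zero par n
    · by_contra hne
      obtain ⟨j, hj⟩ := Fin.exists_succ_eq.mpr hne
      simpa [parentMatrix_pow_apply, hj] using congrFun (congrFun h i) j
  · intro h
    ext i j
    simp [parentMatrix_pow_apply, h, (Fin.succ_ne_zero j).symm]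

theorem isSTree_iff_isNilpotent_parentMatrix {N : ℕ} (par : Fin N → Fin (N + 1)) :
    IsSTree par ↔ IsNilpotent (parentMatrix par) := by
  refine ⟨fun h => ⟨N, (parentMatrix_pow_eq_zero_iff par N).mpr h⟩, fun h => ?_⟩
  have := Matrix.pow_card_eq_zero_of_isNilpotent h
  rw [Fintype.card_fin] at this
  exact (parentMatrix_pow_eq_zero_iff par N).mp this

theorem isSTree_of_forall_exists_iterate {N : ℕ} {par : Fin N → Fin (N + 1)}
    (h : ∀ v, ∃ n, (Step par)^[n] v = 0) : IsSTree par := by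
  choose f hf using h
  rw [isSTree_iff_isNilpotent_parentMatrix]
  refine ⟨Finset.univ.sup f, (parentMatrix_pow_eq_zero_iff par _).mpr fun v => ?_⟩
  obtain ⟨k, hk⟩ := Nat.exists_eq_add_of_le' (Finset.le_sup (f := f) (Finset.mem_univ v))
  rw [hk, Function.iterate_add_apply, hf, Step_iterate_zero]

theorem det_one_sub_parentMatrix_of_not_isSTree {N : ℕ} {par : Fin N → Fin (N + 1)}
    (h : ¬ IsSTree par) : (1 - parentMatrix par).det = 0 := by
  classical
  obtain ⟨v, hv⟩ : ∃ v, ¬ ∃ n, (Step par)^[n] v = 0 := by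
    by_contra! hc
    exact h (isSTree_of_forall_exists_iterate hc)
  let x : Fin (N + 1) → ℝ := fun v => if ∃ n, (Step par)^[n] v = 0 then 0 else 1
  have x_zero : x 0 = 0 := if_pos ⟨0, rfl⟩
  have x_step (i : Fin N) : x (par i) = x i.succ := by
    have : (∃ n, (Step par)^[n] (par i) = 0) ↔ ∃ n, (Step par)^[n] i.succ = 0 := by
      constructor
      · rintro ⟨n, hn⟩
        exact ⟨n + 1, by simpa using hn⟩
      · rintro ⟨_ | n, hn⟩
        · exact absurd hn (Fin.succ_ne_zero i)
        · exact ⟨n, by simpa using hn⟩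
    simp only [x, this]
  rw [← Matrix.exists_mulVec_eq_zero_iff]
  refine ⟨fun i => x i.succ, fun h0 => ?_, ?_⟩
  · rcases Fin.eq_zero_or_eq_succ v with rfl | ⟨i, rfl⟩
    · exact hv ⟨0, rfl⟩
    · simpa [x, hv] using congrFun h0 i
  · ext i
    rw [Matrix.sub_mulVec, Matrix.one_mulVec, Pi.sub_apply, ← x_step, Pi.zero_apply, sub_eq_zero]
    rcases Fin.eq_zero_or_eq_succ (par i) with hp | ⟨k, hp⟩
    · simp [Matrix.mulVec, dotProduct, parentMatrix, hp, x_zero, (Fin.succ_ne_zero _).symm]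
    · simp [Matrix.mulVec, dotProduct, parentMatrix, hp]

theorem det_one_sub_parentMatrix {N : ℕ} (par : Fin N → Fin (N + 1)) :
    (1 - parentMatrix par).det = if IsSTree par then 1 else 0 := by
  split_ifs with h
  · exact Matrix.det_one_sub_of_isNilpotent ((isSTree_iff_isNilpotent_parentMatrix par).mp h)
  · exact det_one_sub_parentMatrix_of_not_isSTree h

theorem stLap_transpose_row {N : ℕ} (w : Fin (N + 2) → Fin (N + 2) → ℝ) (j : Fin (N + 1)) :
    (stLap w).transpose j = ∑ i : Fin (N + 2), w i j.succ •
      fun k : Fin (N + 1) => (1 : Matrix _ _ ℝ) j k - if i = k.succ then 1 else 0 := by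
  ext k
  simp only [Matrix.transpose_apply, stLap, Matrix.of_apply, Finset.sum_apply, Pi.smul_apply,
    smul_eq_mul, mul_sub, Finset.sum_sub_distrib, Matrix.one_apply, mul_ite, mul_one, mul_zero,
    Finset.sum_ite_eq', Finset.mem_univ, if_true]
  rcases eq_or_ne k j with rfl | h
  · simp [Finset.sum_erase_eq_sub]
  · simp [h, h.symm]

/-- directed Matrix–Tree theorem.
For a rooted directed weighted graph with `N + 1 ≥ 1` non-root nodes,
`det L = ∑_{t ∈ T(G)} ∏_{(i,j) ∈ t} w_{ij}`, the normalizing constant over all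
directed spanning trees rooted at `ρ`. -/
theorem det_stLap_eq_sum_strees {N : ℕ}
    (w : Fin (N + 2) → Fin (N + 2) → ℝ) (hw : ∀ i j, 0 ≤ w i j) :
    (stLap w).det
      = ∑ t : Fin (N + 1) → Fin (N + 2), if IsSTree t then treeWeight w t else 0 := by
  calc
    (stLap w).det = (Matrix.detRowAlternating (R := ℝ)).toMultilinearMap
        fun j : Fin (N + 1) => ∑ i : Fin (N + 2), w i j.succ •
          fun k : Fin (N + 1) => (1 : Matrix _ _ ℝ) j k - if i = k.succ then 1 else 0 := by
      rw [← Matrix.det_transpose]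
      exact congrArg Matrix.det (funext (stLap_transpose_row w))
    _ = ∑ t : Fin (N + 1) → Fin (N + 2), treeWeight w t * (1 - parentMatrix t).det := by
      rw [MultilinearMap.map_sum]
      refine Finset.sum_congr rfl fun t _ => ?_
      exact MultilinearMap.map_smul_univ _ (fun j => w (t j) j.succ) _
    _ = _ := by simp only [det_one_sub_parentMatrix, mul_ite, mul_one, mul_zero]
end

section
/- Let G = (ρ, V, w) be a rooted directed weighted graph with N ≥ 1 non-root nodes. For any fixed row index r ∈ {1, …, N}, let L^{(r)} be the N×N matrix with L^{(r)}_{rj} = w_{ρj} for all j; L^{(r)}_{jj} = ∑_{i'∈V∖{ρ,j}} w_{i'j} for j ≠ r; and L^{(r)}_{ij} = −w_{ij} for i ∉ {r, j}. Then det L^{(r)} = ∑_{t∈D(G)} ∏_{(i,j)∈t} w_{ij}; i.e., the single-root Matrix–Tree determinant is the same no matter which row is replaced by the root edge weights. -/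
/-- The root-weighted Laplacian in which row `r` (rather than the first row) is
replaced by the root edge weights: `L^{(r)}_{rj} = w_{ρj}` for all `j`,
`L^{(r)}_{jj} = ∑_{i' ∈ V ∖ {ρ, j}} w_{i'j}` for `j ≠ r`, and
`L^{(r)}_{ij} = -w_{ij}` for `i ∉ {r, j}`.  Non-root nodes are encoded as `Fin (N+1)`. -/
def rootLapRow {N : ℕ} (w : Fin (N + 2) → Fin (N + 2) → ℝ) (r : Fin (N + 1)) :
    Matrix (Fin (N + 1)) (Fin (N + 1)) ℝ :=
  Matrix.of fun i j =>
    if i = r then w 0 j.succ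
    else if i = j then ∑ i' ∈ Finset.univ.erase j, w i'.succ j.succ
    else -w i.succ j.succ

open Finset Matrix Function

lemma step_succ {n : ℕ} (t : Fin n → Fin (n + 1)) (j : Fin n) : Step t j.succ = t j := by
  simp [Step, Fin.succ_ne_zero]

lemma step_iterate_zero {n : ℕ} (t : Fin n → Fin (n + 1)) (k : ℕ) : (Step t)^[k] 0 = 0 :=
  iterate_fixed (by simp [Step]) k

lemma step_iterate_eq_zero_of_le {n : ℕ} {t : Fin n → Fin (n + 1)} {v : Fin (n + 1)} {k l : ℕ}
    (hkl : k ≤ l) (h : (Step t)^[k] v = 0) : (Step t)^[l] v = 0 := by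
  obtain ⟨m, rfl⟩ := Nat.exists_eq_add_of_le' hkl
  rw [iterate_add_apply, h, step_iterate_zero]

/-- A node that reaches the root does so within `n` steps, by the pigeonhole principle. -/
lemma step_iterate_card_eq_zero {n : ℕ} {t : Fin n → Fin (n + 1)} {v : Fin (n + 1)} {k : ℕ}
    (h : (Step t)^[k] v = 0) : (Step t)^[n] v = 0 := by
  have hex : ∃ k, (Step t)^[k] v = 0 := ⟨k, h⟩
  have key : ∀ i j, i < j → j ≤ Nat.find hex → (Step t)^[i] v ≠ (Step t)^[j] v := by
    intro i j hij hj he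
    refine Nat.find_min hex (m := (Nat.find hex - j) + i) (by omega) ?_
    rw [iterate_add_apply, he, ← iterate_add_apply, Nat.sub_add_cancel hj]
    exact Nat.find_spec hex
  have hinj : Injective fun i : Fin (Nat.find hex + 1) => (Step t)^[(i : ℕ)] v := by
    intro i j hij
    rcases lt_trichotomy (i : ℕ) j with hlt | heq | hlt
    · exact absurd hij (key _ _ hlt (by omega))
    · exact Fin.ext heq
    · exact absurd hij.symm (key _ _ hlt (by omega))
  have hcard := Fintype.card_le_of_injective _ hinj
  simp only [Fintype.card_fin] at hcard
  exact step_iterate_eq_zero_of_le (by omega) (Nat.find_spec hex)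

/-- The Laplacian of the graph of a parent function, with the row and column of the root
removed: column `j` is `e_j - e_{t j}`, where `e_0 = 0`. -/
def parentLap {n : ℕ} (t : Fin n → Fin (n + 1)) : Matrix (Fin n) (Fin n) ℝ :=
  of fun i j => (if i = j then 1 else 0) - (if t j = i.succ then 1 else 0)

lemma det_parentLap_of_isSTree {n : ℕ} {t : Fin n → Fin (n + 1)} (h : IsSTree t) :
    (parentLap t).det = 1 := by
  have hex : ∀ v, ∃ k, (Step t)^[k] v = 0 := fun v => ⟨n, h v⟩
  let depth : Fin n → ℕ := fun j => Nat.find (hex j.succ)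
  have hdepth : ∀ i j, t j = i.succ → depth i < depth j := by
    intro i j hij
    have hpos : depth j ≠ 0 := fun h0 => by
      have := Nat.find_spec (hex j.succ)
      rw [show Nat.find (hex j.succ) = 0 from h0] at this
      exact Fin.succ_ne_zero j this
    have hle : depth i ≤ depth j - 1 := by
      refine Nat.find_min' _ ?_
      rw [← hij, ← step_succ t j, ← iterate_succ_apply,
        Nat.succ_eq_add_one, Nat.sub_add_cancel (Nat.pos_of_ne_zero hpos)]
      exact Nat.find_spec (hex j.succ)
    omega
  have htri : (parentLap t).BlockTriangular depth := by
    intro i j hij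
    have h1 : i ≠ j := by rintro rfl; exact lt_irrefl _ hij
    have h2 : t j ≠ i.succ := fun h' => lt_asymm hij (hdepth i j h')
    simp [parentLap, h1, h2]
  rw [htri.det]
  refine prod_eq_one fun a _ => ?_
  suffices (parentLap t).toSquareBlock depth a = 1 by rw [this, det_one]
  ext ⟨i, hi⟩ ⟨j, hj⟩
  have h2 : t j ≠ i.succ := fun h' => (hdepth i j h').ne (hi.trans hj.symm)
  simp [parentLap, toSquareBlock_def, one_apply, h2]

lemma det_parentLap_of_not_isSTree {n : ℕ} {t : Fin n → Fin (n + 1)} (h : ¬ IsSTree t) :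
    (parentLap t).det = 0 := by
  obtain ⟨v, hv⟩ := not_forall.1 h
  let y : Fin (n + 1) → ℝ := fun u => if (Step t)^[n] u = 0 then 0 else 1
  have hy0 : y 0 = 0 := if_pos (step_iterate_zero t n)
  have hystep : ∀ j : Fin n, y (t j) = y j.succ := by
    intro j
    have : (Step t)^[n] (t j) = 0 ↔ (Step t)^[n] j.succ = 0 := by
      rw [← step_succ t j, ← iterate_succ_apply]
      exact ⟨step_iterate_card_eq_zero, step_iterate_eq_zero_of_le n.le_succ⟩
    simp only [y, this]
  refine exists_vecMul_eq_zero_iff.1 ⟨fun i => y i.succ, ?_, ?_⟩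
  · have hv0 : v ≠ 0 := by rintro rfl; exact hv (step_iterate_zero t n)
    obtain ⟨i, rfl⟩ := Fin.exists_succ_eq.2 hv0
    intro h0
    have := congrFun h0 i
    simp [y, hv] at this
  · ext j
    have hsum : ∑ i : Fin n, y i.succ * (if t j = i.succ then 1 else 0) = y (t j) := by
      rcases Fin.eq_zero_or_eq_succ (t j) with h0 | ⟨k, hk⟩
      · simp [h0, hy0, (Fin.succ_ne_zero _).symm]
      · simp [hk]
    have hdiag : ∑ i : Fin n, y i.succ * (if i = j then 1 else 0) = y j.succ := by simp
    simp [vecMul, dotProduct, parentLap, mul_sub, sum_sub_distrib, hsum, hdiag, hystep,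
      -mul_ite]

lemma sum_parentLap {n : ℕ} (t : Fin n → Fin (n + 1)) (j : Fin n) :
    ∑ i, parentLap t i j = if t j = 0 then 1 else 0 := by
  rcases Fin.eq_zero_or_eq_succ (t j) with h0 | ⟨k, hk⟩
  · simp [parentLap, h0, (Fin.succ_ne_zero _).symm]
  · simp [parentLap, hk, Fin.succ_ne_zero]

/-- The matrix whose column `j` is the coefficient vector of `w (t j) j.succ` in column `j`
of `rootLapRow w r`. -/
def parentRow {n : ℕ} (t : Fin n → Fin (n + 1)) (r : Fin n) : Matrix (Fin n) (Fin n) ℝ :=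
  of fun i j => if i = r then (if t j = 0 then 1 else 0)
    else if t j = 0 then 0 else parentLap t i j

lemma det_parentRow_of_card {n : ℕ} {t : Fin n → Fin (n + 1)} (r : Fin n)
    (h : (univ.filter fun j => t j = 0).card = 1) :
    (parentRow t r).det = (parentLap t).det := by
  obtain ⟨j₀, hj₀⟩ := card_eq_one.1 h
  have hroot : ∀ j, t j = 0 ↔ j = j₀ := fun j => by
    simpa using congrArg (j ∈ ·) hj₀
  have hrow : ((parentLap t).updateRow r fun j => if t j = 0 then 1 else 0).det
      = (parentLap t).det := by
    have := det_updateRow_sum (parentLap t) r 1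
    simp only [Pi.one_apply, one_smul] at this
    rw [← this]
    congr 2
    ext j
    exact (sum_parentLap t j).symm.trans (Finset.sum_apply j univ (parentLap t)).symm
  let c : Fin n → ℝ := fun i => if i = r then 0 else parentLap t i j₀
  have hsplit : ((parentLap t).updateRow r fun j => if t j = 0 then 1 else 0)
      = (parentRow t r).updateCol j₀ ((fun i => parentRow t r i j₀) + c) := by
    ext i j
    by_cases hi : i = r <;> by_cases hj : j = j₀ <;>
      simp [updateRow_apply, parentRow, c, hi, hj, hroot]
  have hzero : ((parentRow t r).updateCol j₀ c).det = 0 := by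
    refine det_eq_zero_of_row_eq_zero r fun j => ?_
    by_cases hj : j = j₀ <;> simp [parentRow, c, hj, hroot]
  have hself : (parentRow t r).updateCol j₀ (fun i => parentRow t r i j₀) = parentRow t r :=
    updateCol_eq_self _ _
  rw [← hrow, hsplit, det_updateCol_add, hzero, hself, add_zero]

lemma det_parentRow_of_card_ne {n : ℕ} {t : Fin n → Fin (n + 1)} (r : Fin n)
    (h : (univ.filter fun j => t j = 0).card ≠ 1) : (parentRow t r).det = 0 := by
  by_cases h0 : ∃ j, t j = 0
  · obtain ⟨j, hj⟩ := h0
    have hlt : 1 < (univ.filter fun j => t j = 0).card := by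
      have : 0 < (univ.filter fun j => t j = 0).card := card_pos.2 ⟨j, by simpa using hj⟩
      omega
    obtain ⟨a, ha, b, hb, hab⟩ := one_lt_card.1 hlt
    simp only [mem_filter, mem_univ, true_and] at ha hb
    exact det_zero_of_column_eq hab fun i => by simp [parentRow, ha, hb]
  · push Not at h0
    exact det_eq_zero_of_row_eq_zero r fun j => by simp [parentRow, h0]

lemma det_parentRow {n : ℕ} (t : Fin n → Fin (n + 1)) (r : Fin n) :
    (parentRow t r).det = if IsDTree t then 1 else 0 := by
  by_cases hc : (univ.filter fun j => t j = 0).card = 1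
  · by_cases ht : IsSTree t
    · rw [det_parentRow_of_card r hc, det_parentLap_of_isSTree ht, if_pos ⟨ht, hc⟩]
    · rw [det_parentRow_of_card r hc, det_parentLap_of_not_isSTree ht, if_neg fun h => ht h.1]
  · rw [det_parentRow_of_card_ne r hc, if_neg fun h => hc h.2]

lemma rootLapRow_apply_eq_sum {N : ℕ} (w : Fin (N + 2) → Fin (N + 2) → ℝ)
    (r i j : Fin (N + 1)) :
    rootLapRow w r i j = ∑ p, w p j.succ * parentRow (fun _ => p) r i j := by
  rw [Fin.sum_univ_succ]
  by_cases hi : i = r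
  · simp [rootLapRow, parentRow, hi, Fin.succ_ne_zero]
  · by_cases hij : i = j
    · subst hij
      simp [rootLapRow, parentRow, parentLap, hi, Fin.succ_ne_zero, mul_sub, sum_sub_distrib,
        ← sum_erase_eq_sub]
    · simp [rootLapRow, parentRow, parentLap, hi, hij, Fin.succ_ne_zero]

lemma det_eq_sum_of_columns_eq_sum {m ι R : Type*} [Fintype m] [DecidableEq m] [Fintype ι]
    [CommRing R] (M : Matrix m m R) (a : ι → m → R) (c : ι → m → m → R)
    (h : ∀ i j, M i j = ∑ p, a p j * c p i j) :
    M.det = ∑ t : m → ι, (∏ j, a (t j) j) * (of fun i j => c (t j) i j).det := by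
  have hM : Mᵀ = fun j => ∑ p, a p j • fun i => c p i j := by
    ext j i
    simp [h]
  rw [← det_transpose, hM]
  refine (detRowAlternating.toMultilinearMap.map_sum (fun j p => a p j • fun i => c p i j)).trans ?_
  refine sum_congr rfl fun t _ => ?_
  refine (detRowAlternating.toMultilinearMap.map_smul_univ (fun j => a (t j) j)
    (fun j i => c (t j) i j)).trans ?_
  rw [smul_eq_mul, ← det_transpose (of _)]
  rfl

/-- For any fixed row index `r`, the single-root Matrix–Tree
determinant equals the normalizing constant over dependency trees:
`det L^{(r)} = ∑_{t ∈ D(G)} ∏_{(i,j) ∈ t} w_{ij}`; i.e. the determinant is the same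
no matter which row is replaced by the root edge weights. -/
theorem det_rootLapRow_eq_sum_dtrees {N : ℕ}
    (w : Fin (N + 2) → Fin (N + 2) → ℝ) (hw : ∀ i j, 0 ≤ w i j)
    (r : Fin (N + 1)) :
    (rootLapRow w r).det
      = ∑ t : Fin (N + 1) → Fin (N + 2), if IsDTree t then treeWeight w t else 0 := by
  rw [det_eq_sum_of_columns_eq_sum _ (fun p j => w p j.succ)
    (fun p => parentRow (fun _ => p) r) (rootLapRow_apply_eq_sum w r)]
  refine sum_congr rfl fun t _ => ?_
  have h : (of fun i j => parentRow (fun _ => t j) r i j) = parentRow t r := rfl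
  rw [h, det_parentRow, mul_ite, mul_one, mul_zero]
  rfl
end
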